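/- For i = 1, 2 let (Mᵢ⁰, Mᵢ¹, φ₁) be objects of MF^e_S, let (Nᵢ⁰, Nᵢ¹, φ₁) be objects of 𝓜𝓕_S, and let θᵢ : (Mᵢ⁰, Mᵢ¹, φ₁) → (Nᵢ⁰, Nᵢ¹, φ₁) be φ₁-lifts. Let h : (N₁⁰, N₁¹, φ₁) → (N₂⁰, N₂¹, φ₁) be a morphism. Then the set 𝓛(h) of morphisms f : (M₁⁰, M₁¹, φ₁) → (M₂⁰, M₂¹, φ₁) with θ₂ ∘ f = h ∘ θ₁ is non-empty. -/

import Mathlib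

/-! Setup for Proposition 1.1 of Abrashkin, "Group schemes of period 2".
`S = k⟦t⟧` with `k` algebraically closed of characteristic 2, `σ : s ↦ s²`.
A triple `(M, M1, φ)` consists of an `S`-module `M`, a submodule `M1 ⊆ M` and a
map `φ : M → M` which is additive and `σ`-semilinear on `M1` (this encodes the
`σ`-semilinear map `φ₁ : M¹ → M⁰`; the values of `φ` outside `M1` are irrelevant
since every condition below only refers to its restriction to `M1`). -/

/-- `(N, N1, φ)` is an object of the category `𝓜𝓕_S`. -/
def IsMFTriple (k : Type) [Field k]
    (N : Type) [AddCommGroup N] [Module (PowerSeries k) N]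
    (N1 : Submodule (PowerSeries k) N) (φ : N → N) : Prop :=
  (∀ a ∈ N1, ∀ b ∈ N1, φ (a + b) = φ a + φ b) ∧
  (∀ (s : PowerSeries k), ∀ a ∈ N1, φ (s • a) = s ^ 2 • φ a)

/-- `(M, M1, φ)` is an object of the category `MF^e_S`:  `M` is finite free over
`S`, `t^e·M ⊆ M1`, and `φ₁(M1)` generates `M` over `S`. -/
def IsMFeTriple (k : Type) [Field k] (e : ℕ)
    (M : Type) [AddCommGroup M] [Module (PowerSeries k) M]
    (M1 : Submodule (PowerSeries k) M) (φ : M → M) : Prop :=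
  IsMFTriple k M M1 φ ∧
  Module.Free (PowerSeries k) M ∧ Module.Finite (PowerSeries k) M ∧
  (∀ m : M, (PowerSeries.X : PowerSeries k) ^ e • m ∈ M1) ∧
  Submodule.span (PowerSeries k) (φ '' (M1 : Set M)) = ⊤

/-- `f` is a morphism of triples `(M, M1, φM) → (N, N1, φN)`. -/
def IsMFMorphism (k : Type) [Field k]
    (M : Type) [AddCommGroup M] [Module (PowerSeries k) M]
    (N : Type) [AddCommGroup N] [Module (PowerSeries k) N]
    (M1 : Submodule (PowerSeries k) M) (N1 : Submodule (PowerSeries k) N)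
    (φM : M → M) (φN : N → N) (f : M →ₗ[PowerSeries k] N) : Prop :=
  M1.map f ≤ N1 ∧ ∀ a ∈ M1, f (φM a) = φN (f a)

/-- `θ` is a `φ₁`-lift: a morphism with `θ(M⁰) = N⁰`, `θ(M¹) = N¹` and
`ker θ ⊆ M¹`. -/
def IsPhiLift (k : Type) [Field k]
    (M : Type) [AddCommGroup M] [Module (PowerSeries k) M]
    (N : Type) [AddCommGroup N] [Module (PowerSeries k) N]
    (M1 : Submodule (PowerSeries k) M) (N1 : Submodule (PowerSeries k) N)
    (φM : M → M) (φN : N → N) (θ : M →ₗ[PowerSeries k] N) : Prop :=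
  IsMFMorphism k M N M1 N1 φM φN θ ∧
  Function.Surjective θ ∧ M1.map θ = N1 ∧ LinearMap.ker θ ≤ M1

open PowerSeries in
/-- Fixed points of contracting polynomial maps `y ↦ P (y ^ 2)` on `k⟦t⟧`. -/
theorem aux_root {k : Type} [Field k] [CharP k 2] [IsAlgClosed k]
    (P : Polynomial (PowerSeries k)) : ∃ y : PowerSeries k, P.eval (y ^ 2) = y := by
  classical
  have : CharP (PowerSeries k) 2 :=
    charP_of_injective_ringHom (f := (PowerSeries.C : k →+* PowerSeries k))
      PowerSeries.C_injective 2
  obtain ⟨a, ha⟩ : ∃ a : k, (P.map constantCoeff).eval (a ^ 2) = a := by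
    set R := P.map (constantCoeff : PowerSeries k →+* k)
    obtain ⟨a, ha⟩ := IsAlgClosed.exists_root (Polynomial.expand k 2 R - Polynomial.X) (by
      intro hd
      have h1 := Polynomial.eq_C_of_degree_eq_zero hd
      have h2 := congrArg Polynomial.derivative h1
      have h3 : ((2 : ℕ) : Polynomial k) = 0 := CharP.cast_eq_zero _ 2
      rw [Polynomial.derivative_sub, Polynomial.derivative_expand, h3] at h2
      simp at h2)
    refine ⟨a, ?_⟩
    simpa [Polynomial.IsRoot, Polynomial.expand_eval, sub_eq_zero] using ha
  -- contraction
  have hsq : ∀ x y : PowerSeries k, x ^ 2 - y ^ 2 = (x - y) ^ 2 := by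
    intro x y
    rw [sub_pow_char]
  have hcon : ∀ x y : PowerSeries k, ∀ n, (X : PowerSeries k) ^ (n + 1) ∣ x - y →
      X ^ (n + 2) ∣ P.eval (x ^ 2) - P.eval (y ^ 2) := by
    intro x y n hd
    refine dvd_trans ?_ (Polynomial.sub_dvd_eval_sub _ _ P)
    rw [hsq]
    refine dvd_trans ?_ (pow_dvd_pow_of_dvd hd 2)
    rw [← pow_mul]
    exact pow_dvd_pow _ (by omega)
  let u : ℕ → PowerSeries k := fun n => (fun y => P.eval (y ^ 2))^[n] (C a)
  have hu : ∀ n, u (n + 1) = P.eval (u n ^ 2) := fun n => Function.iterate_succ_apply' _ _ _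
  have hstep : ∀ n, (X : PowerSeries k) ^ (n + 1) ∣ u (n + 1) - u n := by
    intro n
    induction n with
    | zero =>
      rw [zero_add, pow_one, X_dvd_iff, hu]
      have h0 : u 0 = C a := rfl
      rw [h0, map_sub, ← Polynomial.eval_map_apply]
      simp [ha]
    | succ n ih =>
      have := hcon _ _ n ih
      rwa [← hu, ← hu] at this
  have hcauchy : ∀ m n, (X : PowerSeries k) ^ (n + 1) ∣ u (n + m) - u n := by
    intro m n
    induction m with
    | zero => simp
    | succ m ih =>
      have h1 := hstep (n + m)
      have h2 := dvd_add (dvd_trans (pow_dvd_pow (X : PowerSeries k) (by omega : n + 1 ≤ n + m + 1)) h1) ih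
      simpa [add_assoc] using h2
  let y : PowerSeries k := PowerSeries.mk fun n => coeff n (u n)
  have hy : ∀ n, (X : PowerSeries k) ^ (n + 1) ∣ y - u n := by
    intro n
    rw [X_pow_dvd_iff]
    intro m hm
    obtain ⟨d, rfl⟩ := Nat.exists_eq_add_of_le (Nat.lt_succ_iff.mp hm)
    have := (X_pow_dvd_iff.mp (hcauchy d m)) m (Nat.lt_succ_self m)
    rw [map_sub, sub_eq_zero] at this
    simp [y, this]
  refine ⟨y, ?_⟩
  ext n
  have h1 := hcon _ _ n (hy n)
  rw [← hu] at h1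
  have h2 := X_pow_dvd_iff.mp h1 n (by omega)
  have h3 := X_pow_dvd_iff.mp (hy (n + 1)) n (by omega)
  rw [map_sub, sub_eq_zero] at h2 h3
  rw [h2, h3]

/-- Auxiliary polynomials. -/
noncomputable def auxPoly {R : Type} [CommRing R] (a : ℕ → R) : ℕ → Polynomial R
  | 0 => 1 + Polynomial.C (a 0) * Polynomial.X
  | (n + 1) => auxPoly a n ^ 2 + Polynomial.C (a (n + 1)) * Polynomial.X

/-- `1 - F` is surjective for a Frobenius-semilinear `F` on a noetherian `k⟦t⟧`-module. -/
theorem aux_surj {k : Type} [Field k] [CharP k 2] [IsAlgClosed k]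
    {V : Type} [AddCommGroup V] [Module (PowerSeries k) V] [IsNoetherian (PowerSeries k) V]
    (F : V →+ V) (hF : ∀ (s : PowerSeries k) v, F (s • v) = s ^ 2 • F v) (c : V) :
    ∃ x, x - F x = c := by
  classical
  let v : ℕ → V := fun i => F^[i] c
  have hv : ∀ i, F (v i) = v (i + 1) := fun i => (Function.iterate_succ_apply' _ _ _).symm
  have hv0 : v 0 = c := rfl
  obtain ⟨n, a, ha⟩ : ∃ (n : ℕ) (a : ℕ → PowerSeries k),
      ∑ i ∈ Finset.range (n + 1), a i • v i = v (n + 1) := by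
    let G : ℕ →o Submodule (PowerSeries k) V :=
      ⟨fun j => Submodule.span _ (v '' (Finset.range j : Set ℕ)), fun i j hij => by
        apply Submodule.span_mono
        apply Set.image_mono
        simpa using hij⟩
    obtain ⟨m, hm⟩ := monotone_stabilizes_iff_noetherian.mpr
      (inferInstance : IsNoetherian (PowerSeries k) V) G
    have h1 : G (m + 1) = G (m + 2) := (hm _ (by omega)).symm.trans (hm _ (by omega))
    have h2 : v (m + 1) ∈ G (m + 2) :=
      Submodule.subset_span ⟨m + 1, by simp, rfl⟩
    rw [← h1] at h2
    obtain ⟨a, ha⟩ := (Submodule.mem_span_image_finset_iff_exists_fun' (PowerSeries k)).mp h2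
    exact ⟨m, a, ha⟩
  obtain ⟨y, hy⟩ := aux_root (auxPoly a n)
  let x : ℕ → PowerSeries k := fun i => (auxPoly a i).eval (y ^ 2)
  have hx0 : x 0 = 1 + a 0 * y ^ 2 := by simp [x, auxPoly]
  have hxs : ∀ i, x (i + 1) = x i ^ 2 + a (i + 1) * y ^ 2 := fun i => by simp [x, auxPoly]
  have hxn : x n = y := hy
  refine ⟨∑ i ∈ Finset.range (n + 1), x i • v i, ?_⟩
  have e1 : F (∑ i ∈ Finset.range (n + 1), x i • v i) =
      ∑ i ∈ Finset.range n, x i ^ 2 • v (i + 1) +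
        y ^ 2 • ∑ i ∈ Finset.range (n + 1), a i • v i := by
    rw [map_sum, ha, ← hxn, Finset.sum_range_succ]
    simp only [hF, hv]
  rw [e1, Finset.sum_range_succ' (fun i => x i • v i), Finset.sum_range_succ' (fun i => a i • v i),
    smul_add, Finset.smul_sum]
  simp only [hxs, hx0, add_smul, Finset.sum_add_distrib, hv0, one_smul, smul_smul]
  simp only [mul_comm (y ^ 2)]
  abel

/-- **Proposition 1.1 (non-emptiness)** of Abrashkin, "Group schemes of period 2":
given `φ₁`-lifts `θᵢ : 𝓜ᵢ → 𝓝ᵢ` (`𝓜ᵢ ∈ MF^e_S`, `𝓝ᵢ ∈ 𝓜𝓕_S`) and a morphism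
`h : 𝓝₁ → 𝓝₂`, the set `𝓛(h)` of morphisms `f : 𝓜₁ → 𝓜₂` with
`θ₂ ∘ f = h ∘ θ₁` is non-empty. -/
theorem phiLift_exists_lift
    (k : Type) [Field k] [CharP k 2] [IsAlgClosed k]
    (e : ℕ) (he : 1 ≤ e)
    (M₁ : Type) [AddCommGroup M₁] [Module (PowerSeries k) M₁]
    (M₂ : Type) [AddCommGroup M₂] [Module (PowerSeries k) M₂]
    (N₁ : Type) [AddCommGroup N₁] [Module (PowerSeries k) N₁]
    (N₂ : Type) [AddCommGroup N₂] [Module (PowerSeries k) N₂]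
    (M₁1 : Submodule (PowerSeries k) M₁) (M₂1 : Submodule (PowerSeries k) M₂)
    (N₁1 : Submodule (PowerSeries k) N₁) (N₂1 : Submodule (PowerSeries k) N₂)
    (φM₁ : M₁ → M₁) (φM₂ : M₂ → M₂) (φN₁ : N₁ → N₁) (φN₂ : N₂ → N₂)
    (hM₁ : IsMFeTriple k e M₁ M₁1 φM₁) (hM₂ : IsMFeTriple k e M₂ M₂1 φM₂)
    (hN₁ : IsMFTriple k N₁ N₁1 φN₁) (hN₂ : IsMFTriple k N₂ N₂1 φN₂)
    (θ₁ : M₁ →ₗ[PowerSeries k] N₁) (θ₂ : M₂ →ₗ[PowerSeries k] N₂)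
    (hθ₁ : IsPhiLift k M₁ N₁ M₁1 N₁1 φM₁ φN₁ θ₁)
    (hθ₂ : IsPhiLift k M₂ N₂ M₂1 N₂1 φM₂ φN₂ θ₂)
    (h : N₁ →ₗ[PowerSeries k] N₂)
    (hh : IsMFMorphism k N₁ N₂ N₁1 N₂1 φN₁ φN₂ h) :
    ∃ f : M₁ →ₗ[PowerSeries k] M₂,
      IsMFMorphism k M₁ M₂ M₁1 M₂1 φM₁ φM₂ f ∧ θ₂ ∘ₗ f = h ∘ₗ θ₁ := by
  classical
  obtain ⟨⟨hadd₁, hsmul₁⟩, hfree₁, hfin₁, -, hspan₁⟩ := hM₁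
  obtain ⟨⟨hadd₂, hsmul₂⟩, hfree₂, hfin₂, -, -⟩ := hM₂
  obtain ⟨⟨hθ₁1, hθ₁φ⟩, -, hθ₁m, -⟩ := hθ₁
  obtain ⟨⟨hθ₂1, hθ₂φ⟩, hθ₂s, hθ₂m, hθ₂k⟩ := hθ₂
  obtain ⟨hh1, hhφ⟩ := hh
  -- any linear lift preserves the filtration
  have hfil : ∀ f : M₁ →ₗ[PowerSeries k] M₂, θ₂ ∘ₗ f = h ∘ₗ θ₁ → ∀ m ∈ M₁1, f m ∈ M₂1 := by
    intro f hf m hm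
    have h1 : θ₂ (f m) = h (θ₁ m) := LinearMap.congr_fun hf m
    have h2 : h (θ₁ m) ∈ N₂1 := hh1 ⟨_, hθ₁1 ⟨m, hm, rfl⟩, rfl⟩
    rw [← hθ₂m] at h2
    obtain ⟨m', hm', he'⟩ := h2
    have h3 : f m - m' ∈ M₂1 := hθ₂k (by simp [h1, he'])
    simpa using add_mem h3 hm'
  -- T is stable
  have hT : ∀ x ∈ LinearMap.ker θ₂, φM₂ x ∈ LinearMap.ker θ₂ := by
    intro x hx
    have h0 : φN₂ 0 = 0 := by
      have := hN₂.2 0 0 (zero_mem _)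
      simpa using this
    rw [LinearMap.mem_ker, hθ₂φ x (hθ₂k hx), LinearMap.mem_ker.mp hx, h0]
  let ΦT : LinearMap.ker θ₂ →+ LinearMap.ker θ₂ :=
    AddMonoidHom.mk' (fun x => ⟨φM₂ x, hT x x.2⟩) (fun x y => Subtype.ext
      (hadd₂ x (hθ₂k x.2) y (hθ₂k y.2)))
  have hΦT : ∀ (s : PowerSeries k) x, ΦT (s • x) = s ^ 2 • ΦT x := fun s x =>
    Subtype.ext (hsmul₂ s x (hθ₂k x.2))
  have hΦTv : ∀ x, ((ΦT x : LinearMap.ker θ₂) : M₂) = φM₂ x := fun _ => rfl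
  -- semilinear maps
  let Φ₁ : M₁1 →+ M₁ := AddMonoidHom.mk' (fun x => φM₁ x) (fun x y => hadd₁ x x.2 y y.2)
  let Φ₂ : M₂1 →+ M₂ := AddMonoidHom.mk' (fun x => φM₂ x) (fun x y => hadd₂ x x.2 y y.2)
  have hΦ₁ : ∀ (s : PowerSeries k) x, Φ₁ (s • x) = s ^ 2 • Φ₁ x := fun s x => hsmul₁ s x x.2
  have hΦ₂ : ∀ (s : PowerSeries k) x, Φ₂ (s • x) = s ^ 2 • Φ₂ x := fun s x => hsmul₂ s x x.2
  -- bases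
  let b := Module.finBasis (PowerSeries k) M₁1
  let n : Fin (Module.finrank (PowerSeries k) M₁1) → M₁ := fun i => Φ₁ (b i)
  have hnspan : ⊤ ≤ Submodule.span (PowerSeries k) (Set.range n) := by
    rw [← hspan₁, Submodule.span_le]
    rintro _ ⟨m, hm, rfl⟩
    have h1 : φM₁ m = Φ₁ ⟨m, hm⟩ := rfl
    rw [h1, ← b.sum_repr ⟨m, hm⟩, map_sum]
    refine sum_mem fun i _ => ?_
    rw [hΦ₁]
    exact Submodule.smul_mem _ _ (Submodule.subset_span ⟨i, rfl⟩)
  have hli : LinearIndependent (PowerSeries k) n :=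
    linearIndependent_of_top_le_span_of_card_le_finrank hnspan
      (by simpa using Submodule.finrank_le M₁1)
  let B := Module.Basis.mk hli hnspan
  have hB : ∀ i, B i = Φ₁ (b i) := fun i => Module.Basis.mk_apply hli hnspan i
  -- an initial linear lift
  obtain ⟨f₀, hf₀⟩ := Module.projective_lifting_property θ₂ (h ∘ₗ θ₁) hθ₂s
  -- the defect
  have hd : ∀ i, φM₂ (f₀ (b i)) - f₀ (φM₁ (b i)) ∈ LinearMap.ker θ₂ := by
    intro i
    have hm := (b i).2
    have h1 := LinearMap.congr_fun hf₀ (φM₁ (b i))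
    have h2 := LinearMap.congr_fun hf₀ (b i : M₁)
    simp only [LinearMap.comp_apply] at h1 h2
    rw [LinearMap.mem_ker, map_sub, hθ₂φ _ (hfil f₀ hf₀ _ hm), h1, h2, hθ₁φ _ hm,
      hhφ _ (hθ₁1 ⟨_, hm, rfl⟩), sub_self]
  let L : (Fin (Module.finrank (PowerSeries k) M₁1) → LinearMap.ker θ₂) ≃ₗ[PowerSeries k]
      (M₁ →ₗ[PowerSeries k] LinearMap.ker θ₂) := B.constr (PowerSeries k)
  have hL : ∀ x i, L x (B i) = x i := fun x i => B.constr_basis (PowerSeries k) x i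
  let F : (Fin (Module.finrank (PowerSeries k) M₁1) → LinearMap.ker θ₂) →+
      (Fin (Module.finrank (PowerSeries k) M₁1) → LinearMap.ker θ₂) :=
    AddMonoidHom.mk' (fun x i => ΦT (L x (b i))) (fun x y => by
      funext i
      simp)
  obtain ⟨x, hx⟩ := aux_surj F (fun (s : PowerSeries k) x => by
    funext i
    simp [F, hΦT]) (fun i => ⟨_, hd i⟩)
  have hx' : ∀ i, (x i : M₂) - φM₂ (L x (b i)) = φM₂ (f₀ (b i)) - f₀ (φM₁ (b i)) := fun i =>
    congrArg Subtype.val (congrFun hx i)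
  let f : M₁ →ₗ[PowerSeries k] M₂ := f₀ + (LinearMap.ker θ₂).subtype ∘ₗ L x
  have hf : θ₂ ∘ₗ f = h ∘ₗ θ₁ := by
    rw [← hf₀]
    ext m
    have : θ₂ (L x m : M₂) = 0 := (L x m).2
    simp [f, this]
  refine ⟨f, ⟨?_, ?_⟩, hf⟩
  · rintro _ ⟨m, hm, rfl⟩
    exact hfil f hf m hm
  · have hbas : ∀ i, f (Φ₁ (b i)) = Φ₂ ⟨f (b i), hfil f hf _ (b i).2⟩ := by
      intro i
      have h1 : Φ₂ ⟨f (b i), hfil f hf _ (b i).2⟩ = φM₂ (f₀ (b i)) + φM₂ (L x (b i)) :=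
        hadd₂ _ (hfil f₀ hf₀ _ (b i).2) _ (hθ₂k (L x (b i)).2)
      have h2 : f (Φ₁ (b i)) = f₀ (φM₁ (b i)) + x i := by
        have h3 : f (Φ₁ (b i)) = f₀ (φM₁ (b i)) + L x (Φ₁ (b i)) := rfl
        rw [h3, ← hB, hL]
      rw [h1, h2]
      have := hx' i
      rw [sub_eq_sub_iff_add_eq_add] at this
      rw [add_comm, this]
    let fr : M₁1 →ₗ[PowerSeries k] M₂1 :=
      (f ∘ₗ M₁1.subtype).codRestrict M₂1 (fun m => hfil f hf m m.2)
    have key : ∀ m : M₁1, f (Φ₁ m) = Φ₂ (fr m) := by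
      intro m
      rw [← b.sum_repr m]
      simp only [map_sum, map_smul, hΦ₁, hΦ₂]
      exact Finset.sum_congr rfl fun i _ => congrArg _ (hbas i)
    exact fun a ha => key ⟨a, ha⟩
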